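/- arXiv:1912.00072 — 2 statements merged into one kernel-verified Lean document; each statement's English description precedes it below -/
import Mathlib

section
/- Let Ψ : ℝ → ℂ be continuous with Ψ(−ξ) = conjugate(Ψ(ξ)) for all ξ ∈ ℝ, and suppose that Ψ extends to a Rogers function. Then there exist α ≥ 0, β ∈ ℝ, γ ≥ 0 and a nonnegative Borel measure μ on ℝ∖{0} with ∫_{ℝ∖{0}} min{|s|⁻¹, |s|⁻³} μ(ds) < ∞ such that for every ξ ∈ ℝ, Ψ(ξ) = αξ² − iβξ + γ + (1/π) ∫_{ℝ∖{0}} ( ξ/(ξ+is) + i·ξ·sign(s)/(1+|s|) ) μ(ds)/|s|. -/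
open MeasureTheory Filter Set
open scoped ENNReal Topology

noncomputable section

/-- A *Rogers function*: holomorphic on the right half-plane, with `Re (F z / z) ≥ 0` there. -/
def IsRogersFunction (F : ℂ → ℂ) : Prop :=
  DifferentiableOn ℂ F {z : ℂ | 0 < z.re} ∧ ∀ z : ℂ, 0 < z.re → 0 ≤ (F z / z).re

/-- `Ψ` extends to a Rogers function: some Rogers function agrees with `Ψ` on `(0, ∞)`. -/
def ExtendsToRogersFunction (Ψ : ℝ → ℂ) : Prop :=
  ∃ F : ℂ → ℂ, IsRogersFunction F ∧ ∀ ξ : ℝ, 0 < ξ → F (ξ : ℂ) = Ψ ξ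

section Herglotz

open Metric Real

/-- Herglotz representation for functions continuous up to the boundary of the unit disc. -/
lemma DiffContOnCl.exists_finiteMeasure_herglotz {f : ℂ → ℂ}
    (hf : DiffContOnCl ℂ f (ball 0 1)) (hre : ∀ z ∈ sphere (0 : ℂ) 1, 0 ≤ (f z).re) :
    ∃ ν : FiniteMeasure (sphere (0 : ℂ) 1), (ν.mass : ℝ) = (f 0).re ∧ ∀ w ∈ ball (0 : ℂ) 1,
      f w = Complex.I * (f 0).im +
        ∫ ζ, ((ζ : ℂ) + w) / (ζ - w) ∂(ν : Measure (sphere (0 : ℂ) 1)) := by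
  have hcs : ContinuousOn f (sphere 0 1) :=
    hf.continuousOn_ball.mono sphere_subset_closedBall
  have hmem (θ : ℝ) : circleMap 0 1 θ ∈ sphere (0 : ℂ) 1 := circleMap_mem_sphere 0 zero_le_one θ
  have hgc : Continuous fun θ : ℝ => (f (circleMap 0 1 θ)).re :=
    Complex.continuous_re.comp (hcs.comp_continuous (continuous_circleMap 0 1) hmem)
  have hg0 (θ : ℝ) : 0 ≤ (f (circleMap 0 1 θ)).re := hre _ (hmem θ)
  have hreint : CircleIntegrable (fun ζ => (f ζ).re) 0 1 :=
    (Complex.continuous_re.comp_continuousOn hcs).circleIntegrable zero_le_one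
  have hgint : CircleIntegrable (fun ζ => ((f ζ).re : ℂ)) 0 1 :=
    (Complex.continuous_ofReal.comp_continuousOn
      (Complex.continuous_re.comp_continuousOn hcs)).circleIntegrable zero_le_one
  have hd0 (θ : ℝ) : 0 ≤ (2 * π)⁻¹ * (f (circleMap 0 1 θ)).re := by
    have := hg0 θ; positivity
  set m : Measure ℝ := (volume.restrict (Ioc 0 (2 * π))).withDensity
    fun θ => ENNReal.ofReal ((2 * π)⁻¹ * (f (circleMap 0 1 θ)).re) with hm
  have hmfin : IsFiniteMeasure m :=
    isFiniteMeasure_withDensity_ofReal (continuous_const.mul hgc).integrableOn_Ioc.2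
  have hexp : Measurable fun θ : ℝ => (⟨circleMap 0 1 θ, hmem θ⟩ : sphere (0 : ℂ) 1) :=
    ((continuous_circleMap 0 1).subtype_mk hmem).measurable
  have hmeas : Measurable fun θ : ℝ => ENNReal.ofReal ((2 * π)⁻¹ * (f (circleMap 0 1 θ)).re) :=
    (continuous_const.mul hgc).measurable.ennreal_ofReal
  have key (φ : ℂ → ℂ) (hφ : ContinuousOn φ (sphere 0 1)) :
      ∫ ζ, φ ζ ∂(m.map fun θ => (⟨circleMap 0 1 θ, hmem θ⟩ : sphere (0 : ℂ) 1)) =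
        Real.circleAverage (fun ζ => φ ζ • ((f ζ).re : ℂ)) 0 1 := by
    have hφc : Continuous fun ζ : sphere (0 : ℂ) 1 => φ ζ :=
      hφ.comp_continuous continuous_subtype_val fun ζ => ζ.2
    rw [integral_map hexp.aemeasurable hφc.aestronglyMeasurable, hm,
      integral_withDensity_eq_integral_toReal_smul hmeas (by simp),
      Real.circleAverage_def, intervalIntegral.integral_of_le (by positivity), ← integral_smul]
    refine integral_congr_ae (.of_forall fun θ => ?_)
    simp only [ENNReal.toReal_ofReal (hd0 θ), Complex.real_smul, smul_eq_mul]
    push_cast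
    ring
  have hH := differentiableOn_circleAverage_herglotzRieszKernel_smul hgint
  have hH' (w : ℂ) (hw : w ∈ ball (0 : ℂ) 1) :
      ∫ ζ, ((ζ : ℂ) + w) / (ζ - w)
          ∂(m.map fun θ => (⟨circleMap 0 1 θ, hmem θ⟩ : sphere (0 : ℂ) 1)) =
        Real.circleAverage (fun ζ => herglotzRieszKernel 0 w ζ • ((f ζ).re : ℂ)) 0 1 := by
    have := key (herglotzRieszKernel 0 w) (by simpa using continuousOn_herglotzRieszKernel_sphere hw)
    simpa [herglotzRieszKernel_def] using this
  have hreH (w : ℂ) (hw : w ∈ ball (0 : ℂ) 1) :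
      (Real.circleAverage (fun ζ => herglotzRieszKernel 0 w ζ • ((f ζ).re : ℂ)) 0 1).re =
        (f w).re := by
    have hk : ContinuousOn (Complex.re ∘ herglotzRieszKernel 0 w) (sphere 0 1) :=
      Complex.continuous_re.comp_continuousOn
        (by simpa using continuousOn_herglotzRieszKernel_sphere hw)
    rw [re_circleAverage_herglotzRieszKernel_smul hreint hw,
      ← hf.circleAverage_re_herglotzRieszKernel_smul hw]
    have hint : CircleIntegrable ((Complex.re ∘ herglotzRieszKernel 0 w) • f) 0 1 :=
      (hk.smul hcs).circleIntegrable zero_le_one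
    simp only [Real.circleAverage_def, Complex.real_smul, Complex.re_ofReal_mul]
    rw [intervalIntegral.integral_of_le (by positivity),
      intervalIntegral.integral_of_le (by positivity), smul_eq_mul]
    congr 1
    have := (intervalIntegrable_iff_integrableOn_Ioc_of_le (by positivity)).1 hint
    have h2 := Complex.reCLM.integral_comp_comm this
    simpa using h2
  have h0 : (0 : ℂ) ∈ ball (0 : ℂ) 1 := by simp
  have hone (ζ : sphere (0 : ℂ) 1) : ((ζ : ℂ) + 0) / (ζ - 0) = 1 := by
    have : (ζ : ℂ) ≠ 0 := fun h => by simpa [h] using ζ.2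
    simp [this]
  have hmass : Real.circleAverage (fun ζ => herglotzRieszKernel 0 0 ζ • ((f ζ).re : ℂ)) 0 1 =
      ((m.map fun θ => (⟨circleMap 0 1 θ, hmem θ⟩ : sphere (0 : ℂ) 1)).real univ : ℂ) := by
    rw [← hH' 0 h0]
    simp_rw [hone]
    simp
  have hmass' : (m.map fun θ => (⟨circleMap 0 1 θ, hmem θ⟩ : sphere (0 : ℂ) 1)).real univ =
      (f 0).re := by
    rw [← hreH 0 h0, hmass, Complex.ofReal_re]
  have h0H : Real.circleAverage (fun ζ => herglotzRieszKernel 0 0 ζ • ((f ζ).re : ℂ)) 0 1 =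
      ((f 0).re : ℂ) := by
    rw [hmass, hmass']
  obtain ⟨c, hc⟩ := ((hf.differentiableOn.sub hH).analyticOnNhd isOpen_ball).eq_const_of_re_eq_const
    (c₀ := 0) (fun w hw => by rw [Pi.sub_apply, Complex.sub_re, hreH w hw, sub_self]) isOpen_ball
    ⟨⟨0, h0⟩, (convex_ball (0 : ℂ) 1).isPreconnected⟩
  refine ⟨⟨m.map fun θ => (⟨circleMap 0 1 θ, hmem θ⟩ : sphere (0 : ℂ) 1),
    Measure.isFiniteMeasure_map _ _⟩, ?_, fun w hw => ?_⟩
  · exact hmass'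
  · have e1 := hc w hw
    have e2 := hc 0 h0
    simp only [Pi.sub_apply, h0H] at e1 e2
    simp only [FiniteMeasure.toMeasure_mk, hH' w hw]
    have := Complex.re_add_im (f 0)
    linear_combination e1 - e2 - this

/-- **Herglotz representation theorem** on the unit disc. -/
lemma DifferentiableOn.exists_finiteMeasure_herglotz {f : ℂ → ℂ}
    (hf : DifferentiableOn ℂ f (ball 0 1)) (hre : ∀ z ∈ ball (0 : ℂ) 1, 0 ≤ (f z).re) :
    ∃ ν : FiniteMeasure (sphere (0 : ℂ) 1), ∀ w ∈ ball (0 : ℂ) 1,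
      f w = Complex.I * (f 0).im +
        ∫ ζ, ((ζ : ℂ) + w) / (ζ - w) ∂(ν : Measure (sphere (0 : ℂ) 1)) := by
  have hmaps {r : ℝ} (hr : r ∈ Ioo (0 : ℝ) 1) {w : ℂ} (hw : w ∈ closedBall (0 : ℂ) 1) :
      (r : ℂ) * w ∈ ball (0 : ℂ) 1 := by
    simp only [mem_closedBall, dist_zero_right, mem_ball, norm_mul, Complex.norm_real,
      Real.norm_eq_abs, abs_of_pos hr.1] at hw ⊢
    nlinarith [hr.1, hr.2, norm_nonneg w]
  have hex (r : ℝ) : ∃ ν : FiniteMeasure (sphere (0 : ℂ) 1), r ∈ Ioo (0 : ℝ) 1 →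
      (ν.mass : ℝ) = (f 0).re ∧ ∀ w ∈ ball (0 : ℂ) 1, f (r * w) = Complex.I * (f 0).im +
        ∫ ζ, ((ζ : ℂ) + w) / (ζ - w) ∂(ν : Measure (sphere (0 : ℂ) 1)) := by
    by_cases hr : r ∈ Ioo (0 : ℝ) 1
    · have hd : DifferentiableOn ℂ (fun w => f (r * w)) (closedBall 0 1) :=
        hf.comp (by fun_prop) fun w hw => hmaps hr hw
      obtain ⟨ν, h1, h2⟩ := DiffContOnCl.exists_finiteMeasure_herglotz
        (DifferentiableOn.diffContOnCl (hd.mono closure_ball_subset_closedBall))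
        fun z hz => hre _ (hmaps hr (sphere_subset_closedBall hz))
      exact ⟨ν, fun _ => ⟨by simpa using h1, by simpa using h2⟩⟩
    · exact ⟨0, fun h => absurd h hr⟩
  choose ν hν using hex
  set U : Ultrafilter ℝ := Ultrafilter.of (𝓝[<] 1)
  have hU : (U : Filter ℝ) ≤ 𝓝[<] 1 := Ultrafilter.of_le _
  have hIoo : ∀ᶠ r in (U : Filter ℝ), r ∈ Ioo (0 : ℝ) 1 := hU (Ioo_mem_nhdsLT zero_lt_one)
  obtain ⟨ν₀, -, hν₀⟩ := (isCompact_setOfPred_finiteMeasure_le_of_compactSpace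
    (sphere (0 : ℂ) 1) (f 0).re.toNNReal).ultrafilter_le_nhds' (U.map ν) <| by
      rw [Ultrafilter.mem_map]
      filter_upwards [hIoo] with r hr
      exact (NNReal.coe_le_coe.1 (by simp [(hν r hr).1]))
  have hlim : Tendsto ν U (𝓝 ν₀) := hν₀
  rw [FiniteMeasure.tendsto_iff_forall_integral_rclike_tendsto ℂ] at hlim
  refine ⟨ν₀, fun w hw => ?_⟩
  have hc : Continuous fun ζ : sphere (0 : ℂ) 1 => ((ζ : ℂ) + w) / (ζ - w) := by
    refine Continuous.div (by fun_prop) (by fun_prop) fun ζ h => ?_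
    have h1 := ζ.2
    rw [sub_eq_zero] at h
    simp only [mem_sphere, dist_zero_right, h, mem_ball] at h1 hw
    linarith
  have h1 : Tendsto (fun r : ℝ => f (r * w)) U (𝓝 (f w)) := by
    have hcf : ContinuousAt f ((1 : ℝ) * w) :=
      (hf.differentiableAt (isOpen_ball.mem_nhds (by simpa using hw))).continuousAt
    have : ContinuousAt (fun r : ℝ => f (r * w)) 1 :=
      ContinuousAt.comp (f := fun r : ℝ => (r : ℂ) * w) hcf (by fun_prop)
    simpa using this.tendsto.mono_left (hU.trans nhdsWithin_le_nhds)
  refine tendsto_nhds_unique (h1.congr' ?_)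
    ((hlim (BoundedContinuousFunction.mkOfCompact ⟨_, hc⟩)).const_add (Complex.I * (f 0).im))
  filter_upwards [hIoo] with r hr
  simpa using (hν r hr).2 w hw

end Herglotz

section Nevanlinna

open Metric Complex

lemma Complex.re_one_add_div_one_sub_pos {w : ℂ} (hw : ‖w‖ < 1) : 0 < ((1 + w) / (1 - w)).re := by
  have hne : 1 - w ≠ 0 := fun h => by simp [← sub_eq_zero.1 h] at hw
  have h2 := Complex.sq_norm w
  rw [normSq_apply] at h2
  rw [div_re, ← add_div]
  refine div_pos ?_ (normSq_pos.2 hne)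
  simp only [add_re, one_re, sub_re, add_im, one_im, sub_im]
  nlinarith [norm_nonneg w]

lemma Complex.norm_sub_one_div_add_one_lt {z : ℂ} (hz : 0 < z.re) : ‖(z - 1) / (z + 1)‖ < 1 := by
  have hne : z + 1 ≠ 0 := ne_zero_of_re_pos (by simp; linarith)
  rw [norm_div, div_lt_one (norm_pos_iff.2 hne), ← sq_lt_sq₀ (norm_nonneg _) (norm_nonneg _),
    Complex.sq_norm, Complex.sq_norm, normSq_apply, normSq_apply]
  simp only [sub_re, one_re, sub_im, one_im, add_re, add_im]
  nlinarith

lemma Complex.I_mul_im_one_add_div_one_sub {ζ : ℂ} (hζ : ‖ζ‖ = 1) :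
    I * ((1 + ζ) / (1 - ζ)).im = (1 + ζ) / (1 - ζ) := by
  have hre : ((1 + ζ) / (1 - ζ)).re = 0 := by
    have h2 := Complex.sq_norm ζ
    rw [normSq_apply, hζ] at h2
    rw [div_re, ← add_div]
    simp only [add_re, one_re, sub_re, add_im, one_im, sub_im]
    rw [div_eq_zero_iff]
    left
    linarith
  conv_rhs => rw [← re_add_im ((1 + ζ) / (1 - ζ)), hre]
  simp [mul_comm]

/-- Herglotz–Nevanlinna representation of holomorphic functions with nonnegative real part on the
right half-plane. -/
lemma DifferentiableOn.exists_measure_nevanlinna {G : ℂ → ℂ}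
    (hG : DifferentiableOn ℂ G {z | 0 < z.re}) (hre : ∀ z : ℂ, 0 < z.re → 0 ≤ (G z).re) :
    ∃ (b c : ℝ) (ν : Measure ℝ), 0 ≤ c ∧ IsFiniteMeasure ν ∧ ∀ z : ℂ, 0 < z.re →
      G z = I * b + c * z + ∫ s : ℝ, (1 + I * s * z) / (z + I * s) ∂ν := by
  have hd : DifferentiableOn ℂ (fun w => G ((1 + w) / (1 - w))) (ball 0 1) := by
    refine hG.comp (fun w hw => ?_) fun w hw =>
      re_one_add_div_one_sub_pos (mem_ball_zero_iff.1 hw)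
    have hne : 1 - w ≠ 0 := fun h => by simp [← sub_eq_zero.1 h] at hw
    exact (DifferentiableAt.div (by fun_prop) (by fun_prop) hne).differentiableWithinAt
  obtain ⟨ν, hν⟩ := hd.exists_finiteMeasure_herglotz fun w hw =>
    hre _ (re_one_add_div_one_sub_pos (mem_ball_zero_iff.1 hw))
  let one : sphere (0 : ℂ) 1 := ⟨1, by simp⟩
  let T : sphere (0 : ℂ) 1 → ℝ := fun ζ => -((1 + (ζ : ℂ)) / (1 - ζ)).im
  have hT : Measurable T := by fun_prop
  refine ⟨(G ((1 + 0) / (1 - 0))).im, (ν : Measure (sphere (0 : ℂ) 1)).real {one},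
    ((ν : Measure (sphere (0 : ℂ) 1)).restrict {one}ᶜ).map T, measureReal_nonneg,
    Measure.isFiniteMeasure_map _ _, fun z hz => ?_⟩
  have hz1 : z + 1 ≠ 0 := ne_zero_of_re_pos (by simp; linarith)
  set w : ℂ := (z - 1) / (z + 1) with hw
  have hwn : ‖w‖ < 1 := norm_sub_one_div_add_one_lt hz
  have hwz : (1 + w) / (1 - w) = z := by
    have : 1 - w ≠ 0 := fun h => by simp [← sub_eq_zero.1 h] at hwn
    rw [div_eq_iff this, hw]
    field_simp
    ring
  have hne (ζ : sphere (0 : ℂ) 1) : (ζ : ℂ) - w ≠ 0 := fun h => by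
    have h1 := ζ.2
    rw [sub_eq_zero.1 h] at h1
    simp only [mem_sphere, dist_zero_right] at h1
    linarith
  have hc : Continuous fun ζ : sphere (0 : ℂ) 1 => ((ζ : ℂ) + w) / (ζ - w) :=
    Continuous.div (by fun_prop) (by fun_prop) hne
  have hint : Integrable (fun ζ : sphere (0 : ℂ) 1 => ((ζ : ℂ) + w) / (ζ - w))
      (ν : Measure (sphere (0 : ℂ) 1)) :=
    hc.integrable_of_hasCompactSupport (HasCompactSupport.of_compactSpace _)
  have hker (ζ : sphere (0 : ℂ) 1) (hζ : ζ ∈ ({one}ᶜ : Set (sphere (0 : ℂ) 1))) :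
      (1 + I * (T ζ : ℂ) * z) / (z + I * (T ζ : ℂ)) = ((ζ : ℂ) + w) / (ζ - w) := by
    have hζ1 : 1 - (ζ : ℂ) ≠ 0 := fun h => hζ (Subtype.ext (sub_eq_zero.1 h).symm)
    have hIT : I * (T ζ : ℂ) = -((1 + (ζ : ℂ)) / (1 - ζ)) := by
      simp only [T, ofReal_neg, mul_neg]
      rw [I_mul_im_one_add_div_one_sub (by simp)]
    have hzT : z + I * (T ζ : ℂ) ≠ 0 := ne_zero_of_re_pos (by simpa using hz)
    rw [div_eq_div_iff hzT (hne ζ), hIT, hw]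
    field_simp
    ring
  have hmain := hν w (mem_ball_zero_iff.2 hwn)
  rw [hwz, ← integral_add_compl (measurableSet_singleton one) hint, integral_singleton] at hmain
  rw [hmain, integral_map hT.aemeasurable (Measurable.aestronglyMeasurable (by fun_prop)),
    setIntegral_congr_fun (measurableSet_singleton one).compl hker]
  simp only [one, hwz, real_smul, add_assoc]

end Nevanlinna

section LevyKernel

open Complex

/-- The integrand of the Lévy–Khintchine type representation of Rogers functions. -/
def rogersKernel (ξ s : ℝ) : ℂ :=
  ((ξ : ℂ) / ((ξ : ℂ) + I * (s : ℂ)) + I * (ξ : ℂ) * (Real.sign s : ℂ) / ((1 + |s| : ℝ) : ℂ)) /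
    ((|s| : ℝ) : ℂ)

/-- The integrand of the Nevanlinna representation of a Rogers function. -/
def nevanlinnaKernel (ξ s : ℝ) : ℂ :=
  (ξ : ℂ) * ((1 + I * s * ξ) / (ξ + I * s))

/-- The drift correction between `rogersKernel` and `nevanlinnaKernel`. -/
def driftCorrection (s : ℝ) : ℝ :=
  Real.sign s * ((1 - |s|) / (1 + |s|))

lemma Real.measurable_sign : Measurable Real.sign := by
  unfold Real.sign
  exact Measurable.ite measurableSet_Iio measurable_const
    (Measurable.ite measurableSet_Ioi measurable_const measurable_const)

lemma measurable_driftCorrection : Measurable driftCorrection :=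
  Real.measurable_sign.mul (by fun_prop)

lemma measurable_nevanlinnaKernel (ξ : ℝ) : Measurable (nevanlinnaKernel ξ) := by
  unfold nevanlinnaKernel
  fun_prop

lemma abs_driftCorrection_le (s : ℝ) : |driftCorrection s| ≤ 1 := by
  have h0 := abs_nonneg s
  have h1 : |Real.sign s| ≤ 1 := by
    rcases Real.sign_apply_eq s with h | h | h <;> simp [h]
  have h2 : |(1 - |s|) / (1 + |s|)| ≤ 1 := by
    rw [abs_div, abs_of_pos (by linarith : 0 < 1 + |s|), div_le_one (by linarith), abs_le]
    constructor <;> linarith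
  rw [driftCorrection, abs_mul]
  exact mul_le_one₀ h1 (abs_nonneg _) h2

lemma ofReal_add_I_mul_ne_zero (ξ : ℝ) {s : ℝ} (hs : s ≠ 0) : (ξ : ℂ) + I * s ≠ 0 := fun h =>
  hs (by simpa using congrArg Complex.im h)

lemma norm_nevanlinnaKernel_le (ξ : ℝ) (s : ℝ) : ‖nevanlinnaKernel ξ s‖ ≤ 1 + ξ ^ 2 := by
  by_cases hs : s = 0
  · subst hs
    by_cases hξ : ξ = 0
    · simp [nevanlinnaKernel, hξ]
    · simp [nevanlinnaKernel, hξ]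
      positivity
  have hne := ofReal_add_I_mul_ne_zero ξ hs
  have hre : |ξ| ≤ ‖(ξ : ℂ) + I * s‖ := by simpa using abs_re_le_norm ((ξ : ℂ) + I * s)
  have him : |s| ≤ ‖(ξ : ℂ) + I * s‖ := by simpa using abs_im_le_norm ((ξ : ℂ) + I * s)
  rw [nevanlinnaKernel, ← mul_div_assoc, norm_div, div_le_iff₀ (norm_pos_iff.2 hne)]
  have hn : ‖1 + I * (s : ℂ) * ξ‖ ≤ 1 + |s| * |ξ| := by
    refine (norm_add_le _ _).trans ?_
    simp
  rw [norm_mul, norm_real, Real.norm_eq_abs]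
  calc |ξ| * ‖1 + I * (s : ℂ) * ξ‖ ≤ |ξ| * (1 + |s| * |ξ|) := by gcongr
    _ = |ξ| + ξ ^ 2 * |s| := by rw [← sq_abs ξ]; ring
    _ ≤ ‖(ξ : ℂ) + I * s‖ + ξ ^ 2 * ‖(ξ : ℂ) + I * s‖ := by gcongr
    _ = _ := by ring

lemma smul_rogersKernel (ξ s : ℝ) :
    (Real.pi * ((1 + s ^ 2) * |s|)) • rogersKernel ξ s =
      Real.pi * (({0}ᶜ : Set ℝ).indicator (nevanlinnaKernel ξ) s +
        I * ξ * (driftCorrection s : ℂ)) := by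
  by_cases hs : s = 0
  · simp [hs, driftCorrection]
  have hne := ofReal_add_I_mul_ne_zero ξ hs
  have habs : ((|s| : ℝ) : ℂ) ≠ 0 := by simpa using hs
  have h1 : (1 + ((|s| : ℝ) : ℂ)) ≠ 0 := by
    have : (1 + |s|) ≠ 0 := by positivity
    exact_mod_cast this
  have hsign : (s : ℂ) = Real.sign s * ((|s| : ℝ) : ℂ) := by
    rcases lt_or_gt_of_ne hs with h | h
    · simp [Real.sign_of_neg h, abs_of_neg h]
    · simp [Real.sign_of_pos h, abs_of_pos h]
  have hsq : (s : ℂ) ^ 2 = ((|s| : ℝ) : ℂ) ^ 2 := by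
    rw [← ofReal_pow, ← ofReal_pow, sq_abs]
  rw [indicator_of_mem (by simpa using hs), rogersKernel, nevanlinnaKernel, driftCorrection,
    real_smul]
  push_cast
  set a : ℂ := ((|s| : ℝ) : ℂ)
  have hstep : (1 + (s : ℂ) ^ 2) * (ξ / (ξ + I * s)) = ξ * ((1 + I * s * ξ) / (ξ + I * s))
      - I * s * ξ := by
    rw [mul_div_assoc', mul_div_assoc', eq_sub_iff_add_eq, div_add' _ _ _ hne, div_left_inj' hne]
    linear_combination (s : ℂ) ^ 2 * ξ * I_sq
  have hstep2 : (1 + (s : ℂ) ^ 2) * (I * ξ * Real.sign s / (1 + a)) =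
      I * s * ξ + I * ξ * (Real.sign s * ((1 - a) / (1 + a))) := by
    rw [hsq, hsign]
    field_simp
    ring
  have hcancel : (Real.pi : ℂ) * ((1 + (s : ℂ) ^ 2) * a) *
      ((ξ / (ξ + I * s) + I * ξ * Real.sign s / (1 + a)) / a) =
      Real.pi * ((1 + (s : ℂ) ^ 2) * (ξ / (ξ + I * s)) +
        (1 + (s : ℂ) ^ 2) * (I * ξ * Real.sign s / (1 + a))) := by
    rw [mul_div_assoc']
    rw [div_eq_iff habs]
    ring
  rw [hcancel, hstep, hstep2]
  ring

lemma rogersKernel_neg (ξ s : ℝ) :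
    rogersKernel (-ξ) s = starRingEnd ℂ (rogersKernel ξ s) := by
  simp only [rogersKernel, map_div₀, map_add, map_mul, conj_ofReal, conj_I, ofReal_neg]
  congr 2
  · rw [← neg_div_neg_eq]
    congr 1 <;> ring
  · ring

lemma one_add_sq_mul_abs_mul_min_le (s : ℝ) :
    (1 + s ^ 2) * |s| * min |s|⁻¹ ((|s| ^ 3)⁻¹) ≤ 2 := by
  rcases (abs_nonneg s).eq_or_lt with h | h
  · simp [← h]
  rw [← sq_abs s]
  set a := |s|
  rcases le_total a 1 with h1 | h1
  · calc (1 + a ^ 2) * a * min a⁻¹ ((a ^ 3)⁻¹) ≤ (1 + a ^ 2) * a * a⁻¹ := by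
          gcongr; exact min_le_left _ _
      _ = 1 + a ^ 2 := by field_simp
      _ ≤ 2 := by nlinarith
  · calc (1 + a ^ 2) * a * min a⁻¹ ((a ^ 3)⁻¹) ≤ (1 + a ^ 2) * a * (a ^ 3)⁻¹ := by
          gcongr; exact min_le_right _ _
      _ = (1 + a ^ 2) / a ^ 2 := by field_simp
      _ ≤ 2 := by rw [div_le_iff₀ (by positivity)]; nlinarith

/-- The measure with density `π (1 + s²) |s|` with respect to `ν`. -/
def rogersMeasure (ν : Measure ℝ) : Measure ℝ :=
  ν.withDensity fun s => ENNReal.ofReal (Real.pi * ((1 + s ^ 2) * |s|))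

lemma measurable_rogersDensity :
    Measurable fun s : ℝ => ENNReal.ofReal (Real.pi * ((1 + s ^ 2) * |s|)) := by
  fun_prop

lemma rogersMeasure_singleton_zero (ν : Measure ℝ) : rogersMeasure ν {0} = 0 := by
  rw [rogersMeasure, withDensity_apply _ (measurableSet_singleton 0), lintegral_singleton]
  simp

lemma lintegral_min_rogersMeasure_lt_top (ν : Measure ℝ) [IsFiniteMeasure ν] :
    ∫⁻ s : ℝ, ENNReal.ofReal (min |s|⁻¹ ((|s| ^ 3)⁻¹)) ∂(rogersMeasure ν) < ⊤ := by
  rw [rogersMeasure, lintegral_withDensity_eq_lintegral_mul _ measurable_rogersDensity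
    (by fun_prop)]
  refine lt_of_le_of_lt (lintegral_mono fun s => ?_)
    (lintegral_const_lt_top (c := ENNReal.ofReal (Real.pi * 2)) ENNReal.ofReal_ne_top)
  rw [Pi.mul_apply, ← ENNReal.ofReal_mul (by positivity), mul_assoc]
  exact ENNReal.ofReal_le_ofReal
    (mul_le_mul_of_nonneg_left (one_add_sq_mul_abs_mul_min_le s) Real.pi_nonneg)

lemma integrable_indicator_nevanlinnaKernel (ν : Measure ℝ) [IsFiniteMeasure ν] (ξ : ℝ) :
    Integrable (({0}ᶜ : Set ℝ).indicator (nevanlinnaKernel ξ)) ν :=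
  (Integrable.of_bound (measurable_nevanlinnaKernel ξ).aestronglyMeasurable (1 + ξ ^ 2)
    (.of_forall (norm_nevanlinnaKernel_le ξ))).indicator (measurableSet_singleton 0).compl

lemma integrable_driftCorrection (ν : Measure ℝ) [IsFiniteMeasure ν] :
    Integrable driftCorrection ν :=
  Integrable.of_bound measurable_driftCorrection.aestronglyMeasurable 1
    (.of_forall abs_driftCorrection_le)

lemma toReal_rogersDensity_smul (ξ : ℝ) :
    (fun s : ℝ => (ENNReal.ofReal (Real.pi * ((1 + s ^ 2) * |s|))).toReal • rogersKernel ξ s) =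
      fun s => Real.pi * (({0}ᶜ : Set ℝ).indicator (nevanlinnaKernel ξ) s +
        I * ξ * (driftCorrection s : ℂ)) := by
  funext s
  rw [ENNReal.toReal_ofReal (by positivity), smul_rogersKernel]

lemma integrable_rogersKernel (ν : Measure ℝ) [IsFiniteMeasure ν] (ξ : ℝ) :
    Integrable (rogersKernel ξ) (rogersMeasure ν) := by
  rw [rogersMeasure, integrable_withDensity_iff_integrable_smul' measurable_rogersDensity
    (by simp), toReal_rogersDensity_smul]
  exact ((integrable_indicator_nevanlinnaKernel ν ξ).add
    ((integrable_driftCorrection ν).ofReal.const_mul _)).const_mul _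

lemma integral_rogersKernel (ν : Measure ℝ) [IsFiniteMeasure ν] (ξ : ℝ) :
    ((1 / Real.pi : ℝ) : ℂ) * ∫ s, rogersKernel ξ s ∂(rogersMeasure ν) =
      ∫ s in {0}ᶜ, nevanlinnaKernel ξ s ∂ν + I * ξ * ((∫ s, driftCorrection s ∂ν : ℝ) : ℂ) := by
  rw [rogersMeasure, integral_withDensity_eq_integral_toReal_smul measurable_rogersDensity
    (by simp), toReal_rogersDensity_smul, integral_const_mul,
    integral_add (f := ({0}ᶜ : Set ℝ).indicator (nevanlinnaKernel ξ))
      (g := fun s => I * ξ * (driftCorrection s : ℂ)) (integrable_indicator_nevanlinnaKernel ν ξ)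
      ((integrable_driftCorrection ν).ofReal.const_mul _), integral_const_mul,
    integral_indicator (measurableSet_singleton 0).compl, integral_complex_ofReal]
  have : (Real.pi : ℂ) ≠ 0 := by exact_mod_cast Real.pi_ne_zero
  push_cast
  field_simp

lemma tendsto_setIntegral_nevanlinnaKernel (ν : Measure ℝ) [IsFiniteMeasure ν] :
    Tendsto (fun ξ => ∫ s in {0}ᶜ, nevanlinnaKernel ξ s ∂ν) (𝓝 0) (𝓝 0) := by
  have h : Tendsto (fun ξ => ∫ s in {0}ᶜ, nevanlinnaKernel ξ s ∂ν) (𝓝 0)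
      (𝓝 (∫ s in ({0}ᶜ : Set ℝ), (0 : ℂ) ∂ν)) := by
    refine tendsto_integral_filter_of_dominated_convergence (fun _ => 2)
      (.of_forall fun ξ => (measurable_nevanlinnaKernel ξ).aestronglyMeasurable) ?_
      (integrable_const _) ?_
    · filter_upwards [Metric.ball_mem_nhds (0 : ℝ) one_pos] with ξ hξ
      refine .of_forall fun s => (norm_nevanlinnaKernel_le ξ s).trans ?_
      have : |ξ| ≤ 1 := by simpa using (Metric.mem_ball.1 hξ).le
      linarith [(sq_le_one_iff_abs_le_one ξ).2 this]
    · filter_upwards [ae_restrict_mem (measurableSet_singleton (0 : ℝ)).compl] with s hs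
      have hne := ofReal_add_I_mul_ne_zero 0 hs
      have hc : ContinuousAt (fun ξ : ℝ => nevanlinnaKernel ξ s) 0 :=
        ContinuousAt.mul (by fun_prop) (ContinuousAt.div (by fun_prop) (by fun_prop) hne)
      simpa [nevanlinnaKernel] using hc.tendsto
  simpa using h

end LevyKernel

/-- If `Ψ : ℝ → ℂ` is continuous, satisfies `Ψ(−ξ) = conj (Ψ ξ)`, and
extends to a Rogers function, then it admits the representation
`Ψ(ξ) = α ξ² − i β ξ + γ + (1/π) ∫ (ξ/(ξ+is) + i ξ sign(s)/(1+|s|)) μ(ds)/|s|`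
for some `α, γ ≥ 0`, `β ∈ ℝ` and a nonnegative Borel measure `μ` on `ℝ ∖ {0}`
with `∫ min(|s|⁻¹, |s|⁻³) μ(ds) < ∞`. -/
theorem statement1 (Ψ : ℝ → ℂ) (hcont : Continuous Ψ)
    (hsym : ∀ ξ : ℝ, Ψ (-ξ) = starRingEnd ℂ (Ψ ξ))
    (hrog : ExtendsToRogersFunction Ψ) :
    ∃ (α β γ : ℝ) (μ : Measure ℝ), 0 ≤ α ∧ 0 ≤ γ ∧
      μ ({0} : Set ℝ) = 0 ∧
      (∫⁻ s : ℝ, ENNReal.ofReal (min |s|⁻¹ ((|s| ^ 3)⁻¹)) ∂μ) < ⊤ ∧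
      ∀ ξ : ℝ,
        Integrable (fun s : ℝ =>
          ((ξ : ℂ) / ((ξ : ℂ) + Complex.I * (s : ℂ))
            + Complex.I * (ξ : ℂ) * (Real.sign s : ℂ) / ((1 + |s| : ℝ) : ℂ))
              / ((|s| : ℝ) : ℂ)) μ ∧
        Ψ ξ = (α : ℂ) * (ξ : ℂ) ^ 2 - Complex.I * (β : ℂ) * (ξ : ℂ) + (γ : ℂ) +
          ((1 / Real.pi : ℝ) : ℂ) *
            ∫ s : ℝ, ((ξ : ℂ) / ((ξ : ℂ) + Complex.I * (s : ℂ))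
              + Complex.I * (ξ : ℂ) * (Real.sign s : ℂ) / ((1 + |s| : ℝ) : ℂ))
                / ((|s| : ℝ) : ℂ) ∂μ := by
  obtain ⟨F, ⟨hF, hFre⟩, hFΨ⟩ := hrog
  have hz0 {z : ℂ} (hz : 0 < z.re) : z ≠ 0 := Complex.ne_zero_of_re_pos hz
  obtain ⟨b, α, ν, hα, hν, hG⟩ := DifferentiableOn.exists_measure_nevanlinna
    (G := fun z => F z / z) (hF.div differentiableOn_id fun z hz => hz0 hz) hFre
  set R : ℝ := ∫ s, driftCorrection s ∂ν with hR
  set γ : ℝ := ν.real {0} with hγ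
  have hpos (ξ : ℝ) (hξ : 0 < ξ) :
      Ψ ξ = α * ξ ^ 2 + Complex.I * b * ξ + γ + ∫ s in {0}ᶜ, nevanlinnaKernel ξ s ∂ν := by
    have hξ0 : (ξ : ℂ) ≠ 0 := by exact_mod_cast hξ.ne'
    have hint : Integrable (nevanlinnaKernel ξ) ν :=
      Integrable.of_bound (measurable_nevanlinnaKernel ξ).aestronglyMeasurable (1 + ξ ^ 2)
        (.of_forall (norm_nevanlinnaKernel_le ξ))
    have h0 : nevanlinnaKernel ξ 0 = 1 := by simp [nevanlinnaKernel, hξ0]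
    have hsplit : ∫ s, nevanlinnaKernel ξ s ∂ν = γ + ∫ s in {0}ᶜ, nevanlinnaKernel ξ s ∂ν := by
      rw [← integral_add_compl (measurableSet_singleton (0 : ℝ)) hint, integral_singleton, h0]
      simp [hγ]
    have h := hG ξ (by simpa using hξ)
    rw [div_eq_iff hξ0, hFΨ ξ hξ, add_mul, mul_comm (∫ _, _ ∂ν), ← integral_const_mul] at h
    change Ψ ξ = _ + ∫ s, nevanlinnaKernel ξ s ∂ν at h
    rw [h, hsplit]
    ring
  have hzero : Ψ 0 = γ := by
    have h1 : Tendsto Ψ (𝓝[>] 0) (𝓝 (Ψ 0)) := (hcont.tendsto 0).mono_left nhdsWithin_le_nhds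
    have h2 : Tendsto (fun ξ : ℝ => (α : ℂ) * ξ ^ 2 + Complex.I * b * ξ + γ +
        ∫ s in {0}ᶜ, nevanlinnaKernel ξ s ∂ν) (𝓝 0) (𝓝 γ) := by
      have h3 : Tendsto (fun ξ : ℝ => (α : ℂ) * ξ ^ 2 + Complex.I * b * ξ + γ) (𝓝 0) (𝓝 γ) := by
        have : Continuous fun ξ : ℝ => (α : ℂ) * ξ ^ 2 + Complex.I * b * ξ + γ := by fun_prop
        simpa using this.tendsto 0
      simpa using h3.add (tendsto_setIntegral_nevanlinnaKernel ν)
    refine tendsto_nhds_unique (h1.congr' ?_) (h2.mono_left nhdsWithin_le_nhds)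
    filter_upwards [self_mem_nhdsWithin] with ξ hξ using hpos ξ hξ
  have hrepr (ξ : ℝ) (hξ : 0 < ξ) : Ψ ξ = (α : ℂ) * (ξ : ℂ) ^ 2 -
      Complex.I * ((R - b : ℝ) : ℂ) * (ξ : ℂ) + (γ : ℂ) + ((1 / Real.pi : ℝ) : ℂ) *
        ∫ s, rogersKernel ξ s ∂(rogersMeasure ν) := by
    rw [integral_rogersKernel, hpos ξ hξ, ← hR]
    push_cast
    ring
  refine ⟨α, R - b, γ, rogersMeasure ν, hα, measureReal_nonneg, rogersMeasure_singleton_zero ν,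
    lintegral_min_rogersMeasure_lt_top ν, fun ξ => ⟨integrable_rogersKernel ν ξ, ?_⟩⟩
  change Ψ ξ = _ + _ * ∫ s, rogersKernel ξ s ∂(rogersMeasure ν)
  rcases lt_trichotomy ξ 0 with hξ | rfl | hξ
  · obtain ⟨η, rfl⟩ : ∃ η, ξ = -η := ⟨-ξ, (neg_neg ξ).symm⟩
    simp_rw [hsym η, rogersKernel_neg, integral_conj, hrepr η (neg_neg_iff_pos.1 hξ)]
    simp
  · simp [hzero, rogersKernel]
  · exact hrepr ξ hξ
end
end

section
/- Let F be a Rogers function which is not identically zero on the right half-plane. Then there exist a constant c > 0 and a Borel function ϑ : ℝ → [0,π] such that for every z ∈ ℂ with Re z > 0, F(z) = c·exp( (1/π) ∫_{−∞}^{∞} ( z/(z+is) − 1/(1+|s|) ) (ϑ(s)/|s|) ds ), the integral converging absolutely. -/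
open MeasureTheory Filter Set
open scoped ENNReal Topology

noncomputable section

/-- Weak sequential compactness of uniformly bounded functions, tested against `L²` functions. -/
theorem exists_weak_limit_of_bounded {α : Type*} [MeasurableSpace α] (μ : Measure α)
    [IsFiniteMeasure μ] (φ : ℕ → α → ℝ) {C : ℝ} (hC : 0 ≤ C)
    (hφm : ∀ n, AEStronglyMeasurable (φ n) μ) (hφ : ∀ n x, |φ n x| ≤ C) :
    ∃ ψ : α → ℝ, Measurable ψ ∧ (∀ x, |ψ x| ≤ C) ∧
      ∀ (h : α → ℝ) (L : ℝ), MemLp h 2 μ →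
        Tendsto (fun n => ∫ x, h x * φ n x ∂μ) atTop (𝓝 L) → ∫ x, h x * ψ x ∂μ = L := by
  have hmem (n) : MemLp (φ n) 2 μ := MemLp.of_bound (hφm n) C (ae_of_all _ fun x => hφ n x)
  let v (n : ℕ) : Lp ℝ 2 μ := (hmem n).toLp
  let d (n : ℕ) : WeakDual ℝ (Lp ℝ 2 μ) :=
    StrongDual.toWeakDual (InnerProductSpace.toDual ℝ (Lp ℝ 2 μ) (v n))
  have hbound : ∃ R, ∀ n, ‖v n‖ ≤ R := by
    refine ⟨(measureUnivNNReal μ : ℝ) ^ (2 : ℝ≥0∞).toReal⁻¹ * C, fun n => ?_⟩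
    refine Lp.norm_le_of_ae_bound hC ?_
    filter_upwards [(hmem n).coeFn_toLp] with x hx
    rw [hx]; exact hφ n x
  obtain ⟨R, hR⟩ := hbound
  let U := hyperfilter ℕ
  have hU : (U : Filter ℕ) ≤ atTop := Nat.hyperfilter_le_atTop
  obtain ⟨ℓ, -, hℓ⟩ := (WeakDual.isCompact_closedBall (𝕜 := ℝ) (0 : StrongDual ℝ (Lp ℝ 2 μ)) R
    ).ultrafilter_le_nhds (U.map d) (by
      simp only [Ultrafilter.coe_map, le_principal_iff, mem_map]
      refine Filter.univ_mem' fun n => ?_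
      simpa [d] using hR n)
  let p : Lp ℝ 2 μ := (InnerProductSpace.toDual ℝ (Lp ℝ 2 μ)).symm (WeakDual.toStrongDual ℓ)
  have key (h : α → ℝ) (hh : MemLp h 2 μ) :
      Tendsto (fun n => ∫ x, h x * φ n x ∂μ) U (𝓝 (∫ x, h x * p x ∂μ)) := by
    have h1 : Tendsto (fun n => d n hh.toLp) U (𝓝 (ℓ hh.toLp)) :=
      ((WeakDual.eval_continuous (hh.toLp)).tendsto ℓ).comp hℓ
    have e1 (n) : d n hh.toLp = ∫ x, h x * φ n x ∂μ := by
      change inner ℝ (v n) hh.toLp = _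
      rw [L2.inner_def]
      refine integral_congr_ae ?_
      filter_upwards [(hmem n).coeFn_toLp, hh.coeFn_toLp] with x hx hx'
      simp only [v, hx, hx']
      simp
    have e2 : ℓ hh.toLp = ∫ x, h x * p x ∂μ := by
      have : ℓ hh.toLp = inner ℝ p hh.toLp := by
        simp only [p, InnerProductSpace.toDual_symm_apply]
        rfl
      rw [this, L2.inner_def]
      refine integral_congr_ae ?_
      filter_upwards [hh.coeFn_toLp] with x hx'
      simp only [hx']
      simp
    simpa only [e1, e2] using h1
  have hpint : Integrable p μ := (Lp.memLp p).integrable (by norm_num)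
  have hφint (n) : Integrable (φ n) μ := (hmem n).integrable (by norm_num)
  have hset (s : Set α) (hs : MeasurableSet s) :
      Tendsto (fun n => ∫ x in s, φ n x ∂μ) U (𝓝 (∫ x in s, p x ∂μ)) := by
    have := key (s.indicator 1) ((memLp_const (1 : ℝ)).indicator hs)
    have e (f : α → ℝ) : ∫ x, s.indicator 1 x * f x ∂μ = ∫ x in s, f x ∂μ := by
      rw [← integral_indicator hs]
      congr 1; ext x
      by_cases hx : x ∈ s <;> simp [hx]
    simpa only [e] using this
  have hle : (p : α → ℝ) ≤ᵐ[μ] fun _ => C :=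
    ae_le_of_forall_setIntegral_le hpint (integrable_const C) fun s hs _ =>
      le_of_tendsto (hset s hs) (.of_forall fun n =>
        setIntegral_mono (hφint n).integrableOn (integrable_const C).integrableOn
          fun x => (abs_le.1 (hφ n x)).2)
  have hge : (fun _ => -C) ≤ᵐ[μ] (p : α → ℝ) :=
    ae_le_of_forall_setIntegral_le (integrable_const (-C)) hpint fun s hs _ =>
      ge_of_tendsto (hset s hs) (.of_forall fun n =>
        setIntegral_mono (integrable_const (-C)).integrableOn (hφint n).integrableOn
          fun x => (abs_le.1 (hφ n x)).1)
  refine ⟨fun x => max (-C) (min C (p x)), ?_, fun x => ?_, fun h L hh hL => ?_⟩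
  · have : Measurable p := (Lp.stronglyMeasurable p).measurable
    fun_prop
  · rw [abs_le]
    exact ⟨le_max_left _ _, max_le (by linarith) (min_le_left _ _)⟩
  · rw [← tendsto_nhds_unique (key h hh) (hL.mono_left hU)]
    refine integral_congr_ae ?_
    filter_upwards [hle, hge] with x h1 h2
    rw [min_eq_right h1, max_eq_right h2]


/-- Parametrization of the unit circle (minus `-1`) by the real line. -/
def circleParam (s : ℝ) : ℂ := (1 + Complex.I * s) / (1 - Complex.I * s)

theorem one_sub_I_mul_ne_zero (s : ℝ) : (1 - Complex.I * s : ℂ) ≠ 0 := by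
  intro h
  simpa using congrArg Complex.re h

theorem norm_circleParam (s : ℝ) : ‖circleParam s‖ = 1 := by
  have : (1 - Complex.I * s : ℂ) = (starRingEnd ℂ) (1 + Complex.I * s) := by
    simp [sub_eq_add_neg]
  rw [circleParam, norm_div, this, RCLike.norm_conj, div_self]
  rw [← RCLike.norm_conj, ← this, norm_ne_zero_iff]
  exact one_sub_I_mul_ne_zero s

theorem continuous_circleParam : Continuous circleParam := by
  unfold circleParam
  exact Continuous.div (by fun_prop) (by fun_prop) one_sub_I_mul_ne_zero

theorem circleMap_two_mul_arctan (s : ℝ) : circleMap 0 1 (2 * Real.arctan s) = circleParam s := by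
  have hpos : (0 : ℝ) < 1 + s ^ 2 := by positivity
  have hsq : (√(1 + s ^ 2) : ℂ) * (√(1 + s ^ 2) : ℂ) =
      (1 + Complex.I * s) * (1 - Complex.I * s) := by
    rw [← Complex.ofReal_mul, Real.mul_self_sqrt hpos.le]
    push_cast
    linear_combination (s : ℂ) ^ 2 * Complex.I_sq
  have h0 : (√(1 + s ^ 2) : ℂ) ≠ 0 := by
    rw [Ne, Complex.ofReal_eq_zero]
    positivity
  have h1 : Complex.exp (Real.arctan s * Complex.I) = (1 + Complex.I * s) / √(1 + s ^ 2) := by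
    rw [Complex.exp_mul_I, ← Complex.ofReal_cos, ← Complex.ofReal_sin, Real.cos_arctan,
      Real.sin_arctan]
    push_cast
    field_simp
  have h2 := one_sub_I_mul_ne_zero s
  rw [circleMap_zero, circleParam]
  have : ((2 * Real.arctan s : ℝ) : ℂ) * Complex.I
    = Real.arctan s * Complex.I + Real.arctan s * Complex.I := by push_cast; ring
  rw [this, Complex.exp_add, h1, div_mul_div_comm, hsq]
  have h3 : (1 + Complex.I * s : ℂ) ≠ 0 := by
    intro h
    simpa using congrArg Complex.re h
  field_simp
  simp

theorem circleAverage_eq_integral_circleParam (f : ℂ → ℝ) :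
    Real.circleAverage f 0 1 =
      (1 / Real.pi) * ∫ s : ℝ, (1 + s ^ 2)⁻¹ * f (circleParam s) := by
  have himg : (fun s => 2 * Real.arctan s) '' univ = Ioo (-Real.pi) Real.pi := by
    ext θ
    simp only [image_univ, mem_range, mem_Ioo]
    constructor
    · rintro ⟨s, rfl⟩
      constructor <;> linarith [Real.arctan_lt_pi_div_two s, Real.neg_pi_div_two_lt_arctan s]
    · rintro ⟨h1, h2⟩
      exact ⟨Real.tan (θ / 2), by
        rw [Real.arctan_tan (by linarith) (by linarith)]; ring⟩
  have hcv := integral_image_eq_integral_abs_deriv_smul (f := fun s => 2 * Real.arctan s)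
    (f' := fun s => 2 * (1 / (1 + s ^ 2))) MeasurableSet.univ
    (fun x _ => ((Real.hasDerivAt_arctan x).const_mul 2).hasDerivWithinAt)
    (fun x _ y _ h => Real.arctan_injective (by simpa using h))
    (fun θ => f (circleMap 0 1 θ))
  rw [himg] at hcv
  rw [Real.circleAverage_eq_integral_add (-Real.pi),
    intervalIntegral.integral_comp_add_right (fun θ => f (circleMap 0 1 θ)),
    show 0 + -Real.pi = -Real.pi by ring, show 2 * Real.pi + -Real.pi = Real.pi by ring,
    intervalIntegral.integral_of_le (by linarith [Real.pi_pos]), integral_Ioc_eq_integral_Ioo,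
    hcv, Measure.restrict_univ]
  have : ∀ s : ℝ, |2 * (1 / (1 + s ^ 2))| • f (circleMap 0 1 (2 * Real.arctan s))
      = 2 * ((1 + s ^ 2)⁻¹ * f (circleParam s)) := fun s => by
    rw [circleMap_two_mul_arctan, abs_of_nonneg (by positivity), smul_eq_mul]
    ring
  simp_rw [this]
  rw [integral_const_mul, smul_eq_mul]
  field_simp

/-- Poisson representation of the imaginary part of a holomorphic function on the unit disc when
this imaginary part is bounded. -/
theorem exists_poisson_im_of_bounded {g : ℂ → ℂ} {C : ℝ} (hC : 0 ≤ C)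
    (hg : DifferentiableOn ℂ g (Metric.ball 0 1))
    (hgC : ∀ w ∈ Metric.ball (0 : ℂ) 1, |(g w).im| ≤ C) :
    ∃ ψ : ℝ → ℝ, Measurable ψ ∧ (∀ s, |ψ s| ≤ C) ∧ ∀ w ∈ Metric.ball (0 : ℂ) 1,
      (g w).im = (1 / Real.pi) * ∫ s : ℝ, (1 + s ^ 2)⁻¹ *
        ((herglotzRieszKernel 0 w (circleParam s)).re * ψ s) := by
  let μ : Measure ℝ := volume.withDensity fun s => ENNReal.ofReal (1 + s ^ 2)⁻¹
  have hμfin : IsFiniteMeasure μ :=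
    isFiniteMeasure_withDensity_ofReal integrable_inv_one_add_sq.2
  have hμ (f : ℝ → ℝ) : ∫ s, f s ∂μ = ∫ s : ℝ, (1 + s ^ 2)⁻¹ * f s := by
    rw [integral_withDensity_eq_integral_toReal_smul (by fun_prop) (by simp)]
    refine integral_congr_ae (ae_of_all _ fun s => ?_)
    simp only [smul_eq_mul]
    rw [ENNReal.toReal_ofReal (by positivity)]
  let r (n : ℕ) : ℝ := 1 - 1 / ((n : ℝ) + 1)
  have hr0 (n) : 0 ≤ r n := by
    have : 1 / ((n : ℝ) + 1) ≤ 1 := by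
      rw [div_le_one (by positivity)]; linarith [(Nat.cast_nonneg n : (0 : ℝ) ≤ n)]
    simp only [r]; linarith
  have hr1 (n) : r n < 1 := by
    have : 0 < 1 / ((n : ℝ) + 1) := by positivity
    simp only [r]; linarith
  have hrlim : Tendsto r atTop (𝓝 1) := by
    simpa only [sub_zero] using
      (tendsto_one_div_add_atTop_nhds_zero_nat (𝕜 := ℝ)).const_sub (1 : ℝ)
  have hball (n) (w : ℂ) (hw : w ∈ Metric.closedBall (0 : ℂ) 1) :
      (r n : ℂ) * w ∈ Metric.ball (0 : ℂ) 1 := by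
    simp only [mem_closedBall_zero_iff, mem_ball_zero_iff, norm_mul, Complex.norm_real,
      Real.norm_eq_abs, abs_of_nonneg (hr0 n)] at hw ⊢
    calc r n * ‖w‖ ≤ r n * 1 := by gcongr; exact hr0 n
      _ < 1 := by simpa using hr1 n
  have hcp (s : ℝ) : circleParam s ∈ Metric.closedBall (0 : ℂ) 1 := by
    simp [norm_circleParam]
  have hgan := hg.analyticOnNhd Metric.isOpen_ball
  obtain ⟨ψ, hψm, hψC, hψ⟩ := exists_weak_limit_of_bounded μ
    (fun n s => (g (r n * circleParam s)).im) hC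
    (fun n => by
      refine Continuous.aestronglyMeasurable ?_
      refine Complex.continuous_im.comp (hg.continuousOn.comp_continuous ?_ ?_)
      · exact continuous_const.mul continuous_circleParam
      · exact fun s => hball n _ (hcp s))
    (fun n s => hgC _ (hball n _ (hcp s)))
  refine ⟨ψ, hψm, hψC, fun w hw => ?_⟩
  have hpois (n) : (g (r n * w)).im = (1 / Real.pi) * ∫ s,
      (herglotzRieszKernel 0 w (circleParam s)).re * (g (r n * circleParam s)).im ∂μ := by
    have hharm : InnerProductSpace.HarmonicOnNhd (fun w => (g (r n * w)).im)
        (Metric.closedBall 0 1) := fun x hx => by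
      have h1 : AnalyticAt ℂ (fun w : ℂ => g (r n * w)) x :=
        AnalyticAt.fun_comp (hgan _ (hball n x hx)) (by fun_prop)
      exact h1.harmonicAt_im
    rw [← hharm.circleAverage_re_herglotzRieszKernel_smul hw,
      circleAverage_eq_integral_circleParam, hμ]
    rfl
  have hK : Continuous fun s => (herglotzRieszKernel 0 w (circleParam s)).re := by
    refine Complex.continuous_re.comp ?_
    refine ContinuousOn.comp_continuous (s := Metric.sphere 0 |1|)
      (continuousOn_herglotzRieszKernel_sphere hw) continuous_circleParam fun s => ?_
    simp [norm_circleParam]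
  have hKmem : MemLp (fun s => (herglotzRieszKernel 0 w (circleParam s)).re) 2 μ := by
    refine MemLp.of_bound hK.aestronglyMeasurable ((1 + ‖w‖) / (1 - ‖w‖))
      (ae_of_all _ fun s => ?_)
    have hw1 : ‖w‖ < 1 := by simpa using hw
    refine (Complex.abs_re_le_norm _).trans ?_
    rw [herglotzRieszKernel_def, norm_div]
    simp only [sub_zero]
    have h1 := norm_add_le (circleParam s) w
    have h2 := norm_sub_norm_le (circleParam s) w
    rw [norm_circleParam] at h1 h2
    gcongr
  have hlim : Tendsto (fun n => ∫ s,
      (herglotzRieszKernel 0 w (circleParam s)).re * (g (r n * circleParam s)).im ∂μ) atTop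
      (𝓝 (Real.pi * (g w).im)) := by
    have h1 : Tendsto (fun n => (g (r n * w)).im) atTop (𝓝 (g w).im) := by
      refine (Complex.continuous_im.tendsto _).comp ?_
      refine ((hgan w hw).continuousAt.tendsto).comp ?_
      have := (Complex.continuous_ofReal.tendsto 1).comp hrlim
      simpa using this.mul_const w
    convert h1.const_mul Real.pi using 2 with n
    rw [hpois]
    field_simp
  have := hψ _ _ hKmem hlim
  rw [hμ] at this
  rw [this]
  field_simp

theorem herglotzRieszKernel_cayley {z : ℂ} (hz : 0 < z.re) (s : ℝ) :
    (1 + s ^ 2)⁻¹ * (herglotzRieszKernel 0 ((1 - z) / (1 + z)) (circleParam s)).re =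
      z.re / ‖z + Complex.I * s‖ ^ 2 := by
  have h1 : (1 + z : ℂ) ≠ 0 := fun h => by
    have := congrArg Complex.re h
    simp at this; linarith
  have h2 : (z + Complex.I * s : ℂ) ≠ 0 := fun h => by
    have := congrArg Complex.re h
    simp at this; linarith
  have h3 := one_sub_I_mul_ne_zero s
  have hK : herglotzRieszKernel 0 ((1 - z) / (1 + z)) (circleParam s) =
      Complex.I * s + ((1 + s ^ 2 : ℝ) : ℂ) / (z + Complex.I * s) := by
    have e1 : circleParam s + (1 - z) / (1 + z) =
        2 * (1 + Complex.I * s * z) / ((1 - Complex.I * s) * (1 + z)) := by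
      rw [circleParam]; field_simp; ring
    have e2 : circleParam s - (1 - z) / (1 + z) =
        2 * (z + Complex.I * s) / ((1 - Complex.I * s) * (1 + z)) := by
      rw [circleParam]; field_simp; ring
    rw [herglotzRieszKernel_def, sub_zero, sub_zero, e1, e2,
      div_div_div_cancel_right₀ (mul_ne_zero h3 h1)]
    push_cast
    field_simp
    linear_combination (-(s : ℂ) ^ 2) * Complex.I_sq
  have hpos : (0 : ℝ) < 1 + s ^ 2 := by positivity
  rw [hK, Complex.add_re, Complex.sq_norm, div_eq_mul_inv _ (z + Complex.I * s),
    Complex.re_ofReal_mul, Complex.inv_re]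
  simp
  field_simp

theorem exists_poisson_im_halfPlane {g : ℂ → ℂ} {C : ℝ} (hC : 0 ≤ C)
    (hg : DifferentiableOn ℂ g {z : ℂ | 0 < z.re})
    (hgC : ∀ z : ℂ, 0 < z.re → |(g z).im| ≤ C) :
    ∃ ψ : ℝ → ℝ, Measurable ψ ∧ (∀ s, |ψ s| ≤ C) ∧ ∀ z : ℂ, 0 < z.re →
      (g z).im = (1 / Real.pi) * ∫ s : ℝ, z.re / ‖z + Complex.I * s‖ ^ 2 * ψ s := by
  have hne (w : ℂ) (hw : w ∈ Metric.ball (0 : ℂ) 1) : 1 + w ≠ 0 := fun h => by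
    have : w = -1 := by linear_combination h
    simp [this] at hw
  have hmaps (w : ℂ) (hw : w ∈ Metric.ball (0 : ℂ) 1) : 0 < ((1 - w) / (1 + w)).re := by
    have hw' : Complex.normSq w < 1 := by
      rw [Complex.normSq_eq_norm_sq]
      have : ‖w‖ < 1 := by simpa using hw
      nlinarith [norm_nonneg w]
    rw [Complex.div_re, ← add_div]
    refine div_pos ?_ (Complex.normSq_pos.2 (hne w hw))
    rw [Complex.normSq_apply] at hw'
    simp
    nlinarith
  obtain ⟨ψ, hψm, hψC, hψ⟩ := exists_poisson_im_of_bounded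
    (g := fun w => g ((1 - w) / (1 + w))) hC
    (hg.comp (DifferentiableOn.div (by fun_prop) (by fun_prop) hne) hmaps)
    (fun w hw => hgC _ (hmaps w hw))
  refine ⟨ψ, hψm, hψC, fun z hz => ?_⟩
  have h1 : (1 + z : ℂ) ≠ 0 := fun h => by
    have := congrArg Complex.re h
    simp at this; linarith
  have hw : (1 - z) / (1 + z) ∈ Metric.ball (0 : ℂ) 1 := by
    rw [mem_ball_zero_iff, norm_div, div_lt_one (norm_pos_iff.2 h1)]
    refine lt_of_pow_lt_pow_left₀ 2 (norm_nonneg _) ?_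
    rw [Complex.sq_norm, Complex.sq_norm, Complex.normSq_apply, Complex.normSq_apply]
    simp
    nlinarith
  have := hψ _ hw
  simp only [← mul_assoc, herglotzRieszKernel_cayley hz] at this
  rw [← this]
  congr 2
  field_simp
  ring

theorem one_add_abs_le_mul_norm {z : ℂ} {δ R : ℝ} (hδ : 0 < δ) (hz : δ ≤ z.re) (hR : ‖z‖ ≤ R)
    (s : ℝ) : 1 + |s| ≤ (1 + (1 + R) / δ) * ‖z + Complex.I * s‖ := by
  have h1 : |s| ≤ ‖z + Complex.I * s‖ + R := by
    have := norm_sub_le (z + Complex.I * s) z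
    rw [add_sub_cancel_left, norm_mul, Complex.norm_I, one_mul, Complex.norm_real,
      Real.norm_eq_abs] at this
    linarith
  have h2 : δ ≤ ‖z + Complex.I * s‖ := by
    refine le_trans ?_ (Complex.re_le_norm _)
    simpa using hz
  have h3 : 0 ≤ 1 + R := by linarith [norm_nonneg z]
  have h4 : 1 + R ≤ (1 + R) / δ * ‖z + Complex.I * s‖ := by
    rw [div_mul_eq_mul_div, le_div_iff₀ hδ]
    gcongr
  linarith

theorem add_I_mul_ne_zero {z : ℂ} (hz : 0 < z.re) (s : ℝ) : z + Complex.I * s ≠ 0 := fun h => by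
  have := congrArg Complex.re h
  simp at this
  linarith

theorem integrable_poisson_halfPlane {z : ℂ} (hz : 0 < z.re) :
    Integrable (fun s : ℝ => z.re / ‖z + Complex.I * s‖ ^ 2) := by
  refine (integrable_inv_one_add_sq.const_mul (z.re * (1 + (1 + ‖z‖) / z.re) ^ 2)).mono'
    (Measurable.aestronglyMeasurable (by fun_prop)) (ae_of_all _ fun s => ?_)
  have h := one_add_abs_le_mul_norm hz le_rfl le_rfl s
  have hpos : 0 < ‖z + Complex.I * s‖ := norm_pos_iff.2 (add_I_mul_ne_zero hz s)
  rw [Real.norm_of_nonneg (by positivity), ← div_eq_mul_inv,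
    div_le_div_iff₀ (by positivity) (by positivity), mul_assoc]
  refine mul_le_mul_of_nonneg_left ?_ hz.le
  rw [← mul_pow]
  refine le_trans ?_ (pow_le_pow_left₀ (by positivity) h 2)
  nlinarith [abs_nonneg s, sq_abs s]

theorem norm_div_abs_le_one (s : ℝ) : ‖s / |s|‖ ≤ 1 := by
  rw [norm_div, Real.norm_eq_abs, Real.norm_eq_abs, abs_abs]
  exact div_self_le_one _

/-- The Poisson integral of the sign function. -/
theorem integral_sign_poisson {z : ℂ} (hz : 0 < z.re) :
    ∫ s : ℝ, s / |s| * (z.re / ‖z + Complex.I * s‖ ^ 2) = -2 * z.arg := by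
  have hns (s : ℝ) : ‖z + Complex.I * s‖ ^ 2 = z.re ^ 2 + (z.im + s) ^ 2 := by
    rw [Complex.sq_norm, Complex.normSq_apply]; simp; ring
  have hd (s : ℝ) : HasDerivAt (fun s : ℝ => Real.arctan ((z.im + s) / z.re))
      (z.re / ‖z + Complex.I * s‖ ^ 2) s := by
    convert (((hasDerivAt_id' s).const_add z.im).div_const z.re).arctan using 1
    rw [hns]
    have : z.re ^ 2 + (z.im + s) ^ 2 ≠ 0 := by positivity
    simp
    field_simp
  have htop : Tendsto (fun s : ℝ => Real.arctan ((z.im + s) / z.re)) atTop (𝓝 (Real.pi / 2)) :=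
    (tendsto_nhds_of_tendsto_nhdsWithin Real.tendsto_arctan_atTop).comp
      ((tendsto_atTop_add_const_left _ _ tendsto_id).atTop_div_const hz)
  have hbot : Tendsto (fun s : ℝ => Real.arctan ((z.im + s) / z.re)) atBot (𝓝 (-(Real.pi / 2))) :=
    (tendsto_nhds_of_tendsto_nhdsWithin Real.tendsto_arctan_atBot).comp
      ((tendsto_atBot_add_const_left _ _ tendsto_id).atBot_div_const hz)
  have hint := integrable_poisson_halfPlane hz
  have harg : z.arg = Real.arctan (z.im / z.re) := by
    rw [← Complex.tan_arg, Real.arctan_tan]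
    · exact (abs_lt.1 (Complex.abs_arg_lt_pi_div_two_iff.2 (.inl hz))).1
    · exact (abs_lt.1 (Complex.abs_arg_lt_pi_div_two_iff.2 (.inl hz))).2
  have hsint : Integrable (fun s : ℝ => s / |s| * (z.re / ‖z + Complex.I * s‖ ^ 2)) :=
    hint.bdd_mul (Measurable.aestronglyMeasurable (by fun_prop)) (ae_of_all _ norm_div_abs_le_one)
  rw [← intervalIntegral.integral_Iic_add_Ioi (b := 0) hsint.integrableOn hsint.integrableOn,
    integral_Iic_eq_integral_Iio,
    setIntegral_congr_fun (g := fun s : ℝ => - (z.re / ‖z + Complex.I * s‖ ^ 2)) measurableSet_Iio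
      (fun s hs => by
        have hs : s < 0 := hs
        simp only [abs_of_neg hs, div_neg, div_self hs.ne, neg_one_mul]),
    setIntegral_congr_fun (g := fun s : ℝ => (z.re / ‖z + Complex.I * s‖ ^ 2)) measurableSet_Ioi
      (fun s hs => by
        have hs : 0 < s := hs
        simp only [abs_of_pos hs, div_self hs.ne', one_mul]),
    integral_neg, ← integral_Iic_eq_integral_Iio,
    integral_Iic_of_hasDerivAt_of_tendsto' (fun s _ => hd s) hint.integrableOn hbot,
    integral_Ioi_of_hasDerivAt_of_tendsto' (fun s _ => hd s) hint.integrableOn htop, harg]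
  simp
  ring

/-- The integrand of the exponential representation of Rogers functions. -/
def rogersIntegrand (ϑ : ℝ → ℝ) (z : ℂ) (s : ℝ) : ℂ :=
  (z / (z + Complex.I * (s : ℂ)) - (((1 + |s|)⁻¹ : ℝ) : ℂ)) * ((ϑ s / |s| : ℝ) : ℂ)

theorem rogersIntegrand_eq (ϑ : ℝ → ℝ) {z : ℂ} (hz : 0 < z.re) {s : ℝ} (hs : s ≠ 0) :
    rogersIntegrand ϑ z s = ϑ s * ((z - Complex.I * ((s / |s| : ℝ) : ℂ)) /
      ((z + Complex.I * s) * ((1 + |s| : ℝ) : ℂ))) := by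
  have h1 := add_I_mul_ne_zero hz s
  have h2 : ((1 + |s| : ℝ) : ℂ) ≠ 0 := by
    rw [Ne, Complex.ofReal_eq_zero]; positivity
  have h3 : ((|s| : ℝ) : ℂ) ≠ 0 := by
    rw [Ne, Complex.ofReal_eq_zero]; positivity
  rw [rogersIntegrand]
  push_cast at h2 ⊢
  field_simp
  ring

theorem rogersIntegrand_im (ϑ : ℝ → ℝ) {z : ℂ} (hz : 0 < z.re) {s : ℝ} (hs : s ≠ 0) :
    (rogersIntegrand ϑ z s).im = -(s / |s| * ϑ s * (z.re / ‖z + Complex.I * s‖ ^ 2)) := by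
  have h1 := add_I_mul_ne_zero hz s
  have h0 : |s| ≠ 0 := by positivity
  have h3 : ((|s| : ℝ) : ℂ) ≠ 0 := by
    rwa [Ne, Complex.ofReal_eq_zero]
  have : rogersIntegrand ϑ z s = ((ϑ s / |s| * (1 - (1 + |s|)⁻¹) : ℝ) : ℂ) +
      ((s / |s| * ϑ s : ℝ) : ℂ) * (-Complex.I * (z + Complex.I * s)⁻¹) := by
    rw [rogersIntegrand]
    push_cast
    have e : z / (z + Complex.I * s) = 1 - Complex.I * s * (z + Complex.I * s)⁻¹ := by
      field_simp
      ring
    rw [e]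
    ring
  rw [this, Complex.add_im, Complex.ofReal_im, Complex.im_ofReal_mul, Complex.sq_norm]
  simp [Complex.inv_re]

theorem measurable_rogersIntegrand {ϑ : ℝ → ℝ} (hϑ : Measurable ϑ) (z : ℂ) :
    Measurable (rogersIntegrand ϑ z) := by
  unfold rogersIntegrand
  fun_prop

theorem integrable_rogersIntegrand {ϑ : ℝ → ℝ} (hϑ : Measurable ϑ) {M : ℝ}
    (hM : ∀ s, ‖ϑ s‖ ≤ M) {z : ℂ} (hz : 0 < z.re) : Integrable (rogersIntegrand ϑ z) := by
  have hM0 : 0 ≤ M := (norm_nonneg _).trans (hM 0)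
  set C := 1 + (1 + ‖z‖) / z.re
  refine (integrable_inv_one_add_sq.const_mul (M * ((‖z‖ + 1) * C))).mono'
    (measurable_rogersIntegrand hϑ z).aestronglyMeasurable ?_
  filter_upwards [Measure.ae_ne volume (0 : ℝ)] with s hs
  have h := one_add_abs_le_mul_norm hz le_rfl le_rfl s
  have hpos : 0 < ‖z + Complex.I * s‖ := norm_pos_iff.2 (add_I_mul_ne_zero hz s)
  have h1 : (0 : ℝ) < 1 + |s| := by positivity
  have hnum : ‖z - Complex.I * ((s / |s| : ℝ) : ℂ)‖ ≤ ‖z‖ + 1 := by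
    refine (norm_sub_le _ _).trans ?_
    rw [norm_mul, Complex.norm_I, one_mul, Complex.norm_real]
    linarith [norm_div_abs_le_one s]
  rw [rogersIntegrand_eq ϑ hz hs, norm_mul, norm_div, norm_mul, Complex.norm_real,
    Complex.norm_real, Real.norm_of_nonneg h1.le, mul_assoc]
  refine mul_le_mul (hM s) ?_ (by positivity) hM0
  rw [← div_eq_mul_inv, div_le_div_iff₀ (by positivity) (by positivity), mul_assoc]
  refine mul_le_mul hnum ?_ (by positivity) (by positivity)
  calc 1 + s ^ 2 ≤ (1 + |s|) * (1 + |s|) := by nlinarith [abs_nonneg s, sq_abs s]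
    _ ≤ C * ‖z + Complex.I * s‖ * (1 + |s|) := by gcongr
    _ = _ := by ring

theorem differentiableOn_integral_rogersIntegrand {ϑ : ℝ → ℝ} (hϑ : Measurable ϑ) {M : ℝ}
    (hM : ∀ s, ‖ϑ s‖ ≤ M) :
    DifferentiableOn ℂ (fun z => ∫ s, rogersIntegrand ϑ z s) {z : ℂ | 0 < z.re} := by
  intro z₀ (hz₀ : 0 < z₀.re)
  have hM0 : 0 ≤ M := (norm_nonneg _).trans (hM 0)
  have hball (z : ℂ) (hz : z ∈ Metric.ball z₀ (z₀.re / 2)) :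
      z₀.re / 2 ≤ z.re ∧ ‖z‖ ≤ ‖z₀‖ + z₀.re / 2 := by
    rw [mem_ball_iff_norm] at hz
    have h1 := (abs_le.1 (Complex.abs_re_le_norm (z - z₀))).1
    have h2 := norm_sub_norm_le z z₀
    rw [Complex.sub_re] at h1
    constructor <;> linarith
  set C := 1 + (1 + (‖z₀‖ + z₀.re / 2)) / (z₀.re / 2)
  refine (hasDerivAt_integral_of_dominated_loc_of_deriv_le
    (F' := fun z s => (ϑ s : ℂ) * (Complex.I * ((s / |s| : ℝ) : ℂ) / (z + Complex.I * s) ^ 2))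
    (bound := fun s => M * (C ^ 2 * (1 + s ^ 2)⁻¹))
    (Metric.ball_mem_nhds z₀ (half_pos hz₀))
    (.of_forall fun z => (measurable_rogersIntegrand hϑ z).aestronglyMeasurable)
    (integrable_rogersIntegrand hϑ hM hz₀)
    (Measurable.aestronglyMeasurable (by fun_prop))
    (ae_of_all _ fun s z hz => ?_)
    ((integrable_inv_one_add_sq.const_mul _).const_mul _)
    ?_).2.differentiableAt.differentiableWithinAt
  · obtain ⟨h1, h2⟩ := hball z hz
    have h := one_add_abs_le_mul_norm (half_pos hz₀) h1 h2 s
    have hpos : 0 < ‖z + Complex.I * s‖ :=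
      norm_pos_iff.2 (add_I_mul_ne_zero ((half_pos hz₀).trans_le h1) s)
    rw [norm_mul, norm_div, norm_mul, norm_pow, Complex.norm_I, one_mul, Complex.norm_real,
      Complex.norm_real]
    refine mul_le_mul (hM s) ?_ (by positivity) hM0
    rw [← div_eq_mul_inv, div_le_div_iff₀ (by positivity) (by positivity), ← mul_pow]
    calc ‖s / |s|‖ * (1 + s ^ 2) ≤ 1 * (1 + |s|) ^ 2 := by
          gcongr
          · exact norm_div_abs_le_one s
          · nlinarith [abs_nonneg s, sq_abs s]
      _ ≤ _ := by rw [one_mul]; gcongr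
  · filter_upwards [Measure.ae_ne volume (0 : ℝ)] with s hs z hz
    have hz' : 0 < z.re := (half_pos hz₀).trans_le (hball z hz).1
    have h1 := add_I_mul_ne_zero hz' s
    have hd := (((hasDerivAt_id' z).div ((hasDerivAt_id' z).add_const (Complex.I * s)) h1).sub_const
      (((1 + |s|)⁻¹ : ℝ) : ℂ)).mul_const ((ϑ s / |s| : ℝ) : ℂ)
    refine hd.congr_deriv ?_
    have h3 : ((|s| : ℝ) : ℂ) ≠ 0 := by
      rw [Ne, Complex.ofReal_eq_zero]; positivity
    push_cast
    field_simp
    ring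

theorem IsRogersFunction.ne_zero {F : ℂ → ℂ} (hF : IsRogersFunction F)
    (hne : ∃ z : ℂ, 0 < z.re ∧ F z ≠ 0) {z : ℂ} (hz : 0 < z.re) : F z ≠ 0 := by
  intro h0
  have hopen : IsOpen {z : ℂ | 0 < z.re} := isOpen_lt continuous_const Complex.continuous_re
  have hne0 (z : ℂ) (hz : 0 < z.re) : z ≠ 0 := by
    rintro rfl
    simp at hz
  have hd : DifferentiableOn ℂ (fun z => F z / z) {z : ℂ | 0 < z.re} :=
    hF.1.div differentiableOn_id fun z hz => hne0 z hz
  rcases (hd.analyticOnNhd hopen).is_constant_or_isOpen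
    (convex_halfSpace_re_gt 0).isPreconnected with ⟨w, hw⟩ | h
  · obtain ⟨z₁, hz₁, h₁⟩ := hne
    have : F z₁ / z₁ = F z / z := (hw z₁ hz₁).trans (hw z hz).symm
    rw [h0, zero_div] at this
    exact div_ne_zero h₁ (hne0 z₁ hz₁) this
  · have hnhds : (fun z => F z / z) '' {z : ℂ | 0 < z.re} ∈ 𝓝 (0 : ℂ) :=
      (h _ subset_rfl hopen).mem_nhds ⟨z, hz, by simp [h0]⟩
    obtain ⟨ε, hε, hsub⟩ := Metric.mem_nhds_iff.1 hnhds
    obtain ⟨y, hy, hye⟩ := hsub (show ((-(ε / 2) : ℝ) : ℂ) ∈ Metric.ball (0 : ℂ) ε by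
      rw [mem_ball_zero_iff, Complex.norm_real, norm_neg, Real.norm_of_nonneg (by positivity)]
      linarith)
    have := hF.2 y hy
    simp only at hye
    rw [hye, Complex.ofReal_re] at this
    linarith

/-- Every Rogers function `F` which is not identically zero on the right
half-plane has the exponential representation
`F(z) = c exp((1/π) ∫ (z/(z+is) − 1/(1+|s|)) (ϑ(s)/|s|) ds)` for some `c > 0` and some
Borel function `ϑ : ℝ → [0, π]`, the integral converging absolutely. -/
theorem statement3 (F : ℂ → ℂ) (hF : IsRogersFunction F)
    (hne : ∃ z : ℂ, 0 < z.re ∧ F z ≠ 0) :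
    ∃ (c : ℝ) (ϑ : ℝ → ℝ), 0 < c ∧ Measurable ϑ ∧
      (∀ s : ℝ, ϑ s ∈ Set.Icc 0 Real.pi) ∧
      ∀ z : ℂ, 0 < z.re →
        Integrable (fun s : ℝ =>
          (z / (z + Complex.I * (s : ℂ)) - (((1 + |s|)⁻¹ : ℝ) : ℂ))
            * ((ϑ s / |s| : ℝ) : ℂ)) ∧
        F z = (c : ℂ) * Complex.exp (((1 / Real.pi : ℝ) : ℂ) *
          ∫ s : ℝ, (z / (z + Complex.I * (s : ℂ)) - (((1 + |s|)⁻¹ : ℝ) : ℂ))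
            * ((ϑ s / |s| : ℝ) : ℂ)) := by
  have hopen : IsOpen {z : ℂ | 0 < z.re} := isOpen_lt continuous_const Complex.continuous_re
  have hne0 (z : ℂ) (hz : 0 < z.re) : z ≠ 0 := by
    rintro rfl
    simp at hz
  have hf0 (z : ℂ) (hz : 0 < z.re) : F z / z ≠ 0 := div_ne_zero (hF.ne_zero hne hz) (hne0 z hz)
  have hslit (z : ℂ) (hz : 0 < z.re) : F z / z ∈ Complex.slitPlane := by
    rw [Complex.mem_slitPlane_iff]
    rcases (hF.2 z hz).lt_or_eq with h | h
    · exact Or.inl h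
    · exact Or.inr fun h' => hf0 z hz (Complex.ext h.symm h')
  have hd : DifferentiableOn ℂ (fun z => Complex.log (F z / z)) {z : ℂ | 0 < z.re} :=
    (hF.1.div differentiableOn_id fun z hz => hne0 z hz).clog hslit
  obtain ⟨ψ, hψm, hψ, hψint⟩ := exists_poisson_im_halfPlane (C := Real.pi / 2) (by positivity) hd
    fun z hz => by
      rw [Complex.log_im]
      exact Complex.abs_arg_le_pi_div_two_iff.2 (hF.2 z hz)
  let ϑ (s : ℝ) : ℝ := Real.pi / 2 - s / |s| * ψ s
  have hϑm : Measurable ϑ := by fun_prop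
  have hϑ (s : ℝ) : ϑ s ∈ Set.Icc 0 Real.pi := by
    have h : ‖s / |s| * ψ s‖ ≤ 1 * (Real.pi / 2) := by
      rw [norm_mul]
      exact mul_le_mul (norm_div_abs_le_one s) (hψ s) (norm_nonneg _) zero_le_one
    rw [Real.norm_eq_abs, abs_le] at h
    constructor <;> simp only [ϑ] <;> linarith
  have hϑn (s : ℝ) : ‖ϑ s‖ ≤ Real.pi := by
    rw [Real.norm_of_nonneg (hϑ s).1]
    exact (hϑ s).2
  let H (z : ℂ) : ℂ := ((1 / Real.pi : ℝ) : ℂ) * ∫ s, rogersIntegrand ϑ z s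
  have hH : DifferentiableOn ℂ H {z : ℂ | 0 < z.re} :=
    (differentiableOn_integral_rogersIntegrand hϑm hϑn).const_mul _
  have him (z : ℂ) (hz : 0 < z.re) : (H z).im = z.arg + (Complex.log (F z / z)).im := by
    have hP := integrable_poisson_halfPlane hz
    have i1 : Integrable (fun s : ℝ => z.re / ‖z + Complex.I * s‖ ^ 2 * ψ s) :=
      hP.mul_bdd hψm.aestronglyMeasurable (ae_of_all _ hψ)
    have i2 : Integrable (fun s : ℝ => s / |s| * (z.re / ‖z + Complex.I * s‖ ^ 2)) :=
      hP.bdd_mul (Measurable.aestronglyMeasurable (by fun_prop)) (ae_of_all _ norm_div_abs_le_one)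
    have e : ∫ s, (rogersIntegrand ϑ z s).im = ∫ s : ℝ, (z.re / ‖z + Complex.I * s‖ ^ 2 * ψ s -
        Real.pi / 2 * (s / |s| * (z.re / ‖z + Complex.I * s‖ ^ 2))) := by
      refine integral_congr_ae ?_
      filter_upwards [Measure.ae_ne volume (0 : ℝ)] with s hs
      rw [rogersIntegrand_im ϑ hz hs]
      have hs2 : s / |s| * (s / |s|) = 1 := by
        have : |s| ≠ 0 := by positivity
        rw [div_mul_div_comm, abs_mul_abs_self, div_self (by positivity)]
      simp only [ϑ]
      linear_combination (z.re / ‖z + Complex.I * s‖ ^ 2 * ψ s) * hs2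
    have hI : (∫ s, rogersIntegrand ϑ z s).im = ∫ s, (rogersIntegrand ϑ z s).im :=
      (integral_im (integrable_rogersIntegrand hϑm hϑn hz)).symm
    rw [Complex.im_ofReal_mul, hI, e, integral_sub i1 (i2.const_mul _), integral_const_mul,
      integral_sign_poisson hz, hψint z hz]
    field_simp
    ring
  obtain ⟨a, ha⟩ := AnalyticOnNhd.eq_const_add_im_mul_I_of_re_eq_const
    (U := {z : ℂ | 0 < z.re}) (c₀ := 0)
    (((differentiableOn_id.clog fun z hz => Or.inl hz).add hd).sub hH |>.analyticOnNhd hopen)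
    (fun z hz => by
      simp only [Pi.sub_apply, Pi.add_apply, Complex.sub_im, Complex.add_im, him z hz, id,
        Complex.log_im]
      ring) hopen ⟨⟨1, by simp⟩, (convex_halfSpace_re_gt 0).isPreconnected⟩
  refine ⟨Real.exp a, ϑ, Real.exp_pos a, hϑm, hϑ, fun z hz =>
    ⟨integrable_rogersIntegrand hϑm hϑn hz, ?_⟩⟩
  have haz := ha z hz
  simp only [Pi.sub_apply, Pi.add_apply, id, Complex.ofReal_zero, zero_mul, add_zero] at haz
  change F z = Real.exp a * Complex.exp (H z)
  rw [Complex.ofReal_exp, ← Complex.exp_add, ← haz, sub_add_cancel, Complex.exp_add,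
    Complex.exp_log (hne0 z hz), Complex.exp_log (hf0 z hz), mul_div_cancel₀ _ (hne0 z hz)]
end
end
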